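/- Let K be a field, n ≥ 2 an integer, and r, s ≥ 1 integers with gcd(r, n−1) = gcd(s, n−1). Then the matrix rings M_r(L_n) and M_s(L_n) are isomorphic as K-algebras. -/

import Mathlib

open scoped BigOperators

/-- Defining relations of the Leavitt algebra `L_K(1,n)`. -/
inductive LeavittRel (K : Type) [Field K] (n : ℕ) :
    FreeAlgebra K (Fin n ⊕ Fin n) → FreeAlgebra K (Fin n ⊕ Fin n) → Prop
  | xy (i j : Fin n) :
      LeavittRel K n (FreeAlgebra.ι K (Sum.inl i) * FreeAlgebra.ι K (Sum.inr j))
        (if i = j then 1 else 0)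
  | yx :
      LeavittRel K n (∑ j : Fin n, FreeAlgebra.ι K (Sum.inr j) * FreeAlgebra.ι K (Sum.inl j)) 1

/-- The Leavitt algebra `L_n = L_K(1,n)`. -/
abbrev Leavitt (K : Type) [Field K] (n : ℕ) := RingQuot (LeavittRel K n)

/-- The generator `x_i` of the Leavitt algebra. -/
noncomputable def lx (K : Type) [Field K] (n : ℕ) (i : Fin n) : Leavitt K n :=
  RingQuot.mkAlgHom K (LeavittRel K n) (FreeAlgebra.ι K (Sum.inl i))

/-- The generator `y_i` of the Leavitt algebra. -/
noncomputable def ly (K : Type) [Field K] (n : ℕ) (i : Fin n) : Leavitt K n :=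
  RingQuot.mkAlgHom K (LeavittRel K n) (FreeAlgebra.ι K (Sum.inr i))

/-- `x_I = x_{i_k} ⋯ x_{i_1}` for a word `I = (i_1, …, i_k)`. -/
noncomputable def xW (K : Type) [Field K] (n : ℕ) (I : List (Fin n)) : Leavitt K n :=
  (I.reverse.map (lx K n)).prod

/-- `y_I = y_{i_1} ⋯ y_{i_k}` for a word `I = (i_1, …, i_k)`. -/
noncomputable def yW (K : Type) [Field K] (n : ℕ) (I : List (Fin n)) : Leavitt K n :=
  (I.map (ly K n)).prod

/-- Auxiliary anti-homomorphism used to construct the involution on `L_n`. -/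
noncomputable def leavittStarAux (K : Type) [Field K] (n : ℕ) :
    FreeAlgebra K (Fin n ⊕ Fin n) →ₐ[K] (Leavitt K n)ᵐᵒᵖ :=
  FreeAlgebra.lift K fun s =>
    MulOpposite.op (RingQuot.mkAlgHom K (LeavittRel K n) (FreeAlgebra.ι K s.swap))

theorem leavittStarAux_rel (K : Type) [Field K] (n : ℕ) :
    ∀ ⦃a b : FreeAlgebra K (Fin n ⊕ Fin n)⦄, LeavittRel K n a b →
      leavittStarAux K n a = leavittStarAux K n b := by
  intro a b h
  induction h with
  | xy i j =>
    have h1 : (RingQuot.mkAlgHom K (LeavittRel K n))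
        (FreeAlgebra.ι K (Sum.inl j) * FreeAlgebra.ι K (Sum.inr i)) =
        (RingQuot.mkAlgHom K (LeavittRel K n)) (if j = i then 1 else 0) :=
      RingQuot.mkAlgHom_rel K (LeavittRel.xy j i)
    simp only [leavittStarAux, map_mul, FreeAlgebra.lift_ι_apply, Sum.swap_inl, Sum.swap_inr]
    rw [← MulOpposite.op_mul, ← map_mul, h1]
    by_cases hij : i = j
    · subst hij; simp
    · simp [hij, Ne.symm hij]
  | yx =>
    have h1 : (RingQuot.mkAlgHom K (LeavittRel K n))
        (∑ j : Fin n, FreeAlgebra.ι K (Sum.inr j) * FreeAlgebra.ι K (Sum.inl j)) =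
        (RingQuot.mkAlgHom K (LeavittRel K n)) 1 :=
      RingQuot.mkAlgHom_rel K LeavittRel.yx
    simp only [leavittStarAux, map_sum, map_mul, FreeAlgebra.lift_ι_apply, Sum.swap_inl,
      Sum.swap_inr, map_one]
    have key : ∀ x : Fin n,
        MulOpposite.op ((RingQuot.mkAlgHom K (LeavittRel K n)) (FreeAlgebra.ι K (Sum.inl x))) *
          MulOpposite.op ((RingQuot.mkAlgHom K (LeavittRel K n)) (FreeAlgebra.ι K (Sum.inr x))) =
        MulOpposite.opAddEquiv ((RingQuot.mkAlgHom K (LeavittRel K n))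
          (FreeAlgebra.ι K (Sum.inr x) * FreeAlgebra.ι K (Sum.inl x))) := by
      intro x; rw [map_mul]; rfl
    rw [Finset.sum_congr rfl fun x _ => key x, ← map_sum, ← map_sum, h1, map_one]
    rfl

/-- The involution `*` on the Leavitt algebra, as an algebra map into the opposite algebra. -/
noncomputable def lstarHom (K : Type) [Field K] (n : ℕ) :
    Leavitt K n →ₐ[K] (Leavitt K n)ᵐᵒᵖ :=
  RingQuot.liftAlgHom K ⟨leavittStarAux K n, leavittStarAux_rel K n⟩

/-- The involution `*` on the Leavitt algebra: the unique `K`-linear ring anti-automorphism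
with `x_i* = y_i` and `y_i* = x_i`. -/
noncomputable def lstar (K : Type) [Field K] (n : ℕ) (a : Leavitt K n) : Leavitt K n :=
  (lstarHom K n a).unop

/-- An element of `L_n` which is a finite (possibly empty) sum of monomials `y_I x_J`. -/
def IsSumYX (K : Type) [Field K] (n : ℕ) (a : Leavitt K n) : Prop :=
  ∃ (m : ℕ) (I J : Fin m → List (Fin n)), a = ∑ i, yW K n (I i) * xW K n (J i)

/-- The induced involution on matrices over `L_n`: `(A*)_{ij} = (A_{ji})*`. -/
noncomputable def mstar (K : Type) [Field K] (n r : ℕ)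
    (A : Matrix (Fin r) (Fin r) (Leavitt K n)) : Matrix (Fin r) (Fin r) (Leavitt K n) :=
  fun i j => lstar K n (A j i)

/-- The set `P_{n,r}` of unitary matrices over `L_n` all of whose entries are finite sums of
monomials `y_I x_J`. -/
def PsetM (K : Type) [Field K] (n r : ℕ) : Set (Matrix (Fin r) (Fin r) (Leavitt K n)) :=
  {A | (A * mstar K n r A = 1 ∧ mstar K n r A * A = 1) ∧ ∀ i j, IsSumYX K n (A i j)}

/-- `B` is a complete prefix code: a finite nonempty set of pairwise incomparable words such
that every word is comparable with some element of `B`. -/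
def IsCPC (n : ℕ) (B : Set (List (Fin n))) : Prop :=
  B.Finite ∧ B.Nonempty ∧ (∀ u ∈ B, ∀ v ∈ B, u ≠ v → ¬ u <+: v) ∧
    (∀ w : List (Fin n), ∃ u ∈ B, u <+: w ∨ w <+: u)

section Leavitt

variable {K : Type} [Field K] {n : ℕ}

theorem lx_mul_ly (i j : Fin n) : lx K n i * ly K n j = if i = j then 1 else 0 := by
  rw [lx, ly, ← map_mul, RingQuot.mkAlgHom_rel K (LeavittRel.xy i j)]
  split_ifs <;> simp

theorem sum_ly_mul_lx : ∑ j, ly K n j * lx K n j = 1 := by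
  simpa [lx, ly] using RingQuot.mkAlgHom_rel K (LeavittRel.yx (K := K) (n := n))

/-- The universal property of the Leavitt algebra. -/
theorem exists_leavittLift {S : Type} [Ring S] [Algebra K S] (x y : Fin n → S)
    (hxy : ∀ i j, x i * y j = if i = j then 1 else 0) (hyx : ∑ j, y j * x j = 1) :
    ∃ φ : Leavitt K n →ₐ[K] S, (∀ i, φ (lx K n i) = x i) ∧ ∀ i, φ (ly K n i) = y i := by
  refine ⟨RingQuot.liftAlgHom K ⟨FreeAlgebra.lift K (Sum.elim x y), ?_⟩, fun i => ?_, fun i => ?_⟩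
  · intro a b h
    induction h with
    | xy i j =>
      simp only [map_mul, FreeAlgebra.lift_ι_apply, Sum.elim_inl, Sum.elim_inr, hxy]
      split_ifs <;> simp
    | yx => simp [hyx]
  · simp [lx]
  · simp [ly]

theorem leavitt_subalgebra_eq_top (R : Subalgebra K (Leavitt K n))
    (hx : ∀ i, lx K n i ∈ R) (hy : ∀ i, ly K n i ∈ R) : R = ⊤ := by
  rw [eq_top_iff]
  rintro a -
  obtain ⟨a, rfl⟩ := RingQuot.mkAlgHom_surjective K (LeavittRel K n) a
  induction a using FreeAlgebra.induction with
  | grade0 r => rw [AlgHom.commutes]; exact R.algebraMap_mem r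
  | grade1 s =>
    cases s with
    | inl i => exact hx i
    | inr i => exact hy i
  | mul a b ha hb => rw [map_mul]; exact R.mul_mem ha hb
  | add a b ha hb => rw [map_add]; exact R.add_mem ha hb

theorem xW_cons (i : Fin n) (I : List (Fin n)) : xW K n (i :: I) = xW K n I * lx K n i := by
  simp [xW]

theorem yW_cons (i : Fin n) (I : List (Fin n)) : yW K n (i :: I) = ly K n i * yW K n I := by
  simp [yW]

theorem yW_append (I J : List (Fin n)) : yW K n (I ++ J) = yW K n I * yW K n J := by
  simp [yW]

theorem xW_mul_yW_self (I : List (Fin n)) : xW K n I * yW K n I = 1 := by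
  induction I with
  | nil => simp [xW, yW]
  | cons i I ih =>
    rw [xW_cons, yW_cons, mul_assoc, ← mul_assoc (lx K n i), lx_mul_ly, if_pos rfl, one_mul, ih]

theorem xW_mul_yW_of_not_prefix (I J : List (Fin n)) (hIJ : ¬ I <+: J) (hJI : ¬ J <+: I) :
    xW K n I * yW K n J = 0 := by
  induction I generalizing J with
  | nil => exact absurd List.nil_prefix hIJ
  | cons i I ih =>
    cases J with
    | nil => exact absurd List.nil_prefix hJI
    | cons j J =>
      rw [xW_cons, yW_cons, mul_assoc, ← mul_assoc (lx K n i), lx_mul_ly]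
      split_ifs with h
      · subst h
        rw [one_mul]
        exact ih J (fun h => hIJ (by simpa using h)) (fun h => hJI (by simpa using h))
      · simp

/-- Right multiplication by long words in the `y_i` turns every element into a linear combination
of words in the `y_i`. -/
theorem exists_mul_yW_mem_span (a : Leavitt K n) :
    ∃ N, ∀ I : List (Fin n), N ≤ I.length →
      a * yW K n I ∈ Submodule.span K (Set.range (yW K n)) := by
  obtain ⟨a, rfl⟩ := RingQuot.mkAlgHom_surjective K (LeavittRel K n) a
  induction a using FreeAlgebra.induction with
  | grade0 r =>
    refine ⟨0, fun I _ => ?_⟩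
    rw [AlgHom.commutes, ← Algebra.smul_def]
    exact Submodule.smul_mem _ _ (Submodule.subset_span ⟨I, rfl⟩)
  | grade1 s =>
    cases s with
    | inl i =>
      refine ⟨1, fun I hI => ?_⟩
      cases I with
      | nil => simp at hI
      | cons j I =>
        change lx K n i * _ ∈ _
        rw [yW_cons, ← mul_assoc, lx_mul_ly]
        split_ifs
        · rw [one_mul]; exact Submodule.subset_span ⟨I, rfl⟩
        · simp
    | inr i =>
      refine ⟨0, fun I _ => ?_⟩
      change ly K n i * _ ∈ _
      rw [← yW_cons]
      exact Submodule.subset_span ⟨_, rfl⟩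
  | mul a b ha hb =>
    obtain ⟨N, hN⟩ := ha
    obtain ⟨M, hM⟩ := hb
    refine ⟨M + N, fun I hI => ?_⟩
    have hb' := hM (I.take M) (by simp; omega)
    rw [← List.take_append_drop M I, yW_append, map_mul, mul_assoc, ← mul_assoc _ (yW K n _)]
    generalize RingQuot.mkAlgHom K (LeavittRel K n) b * yW K n (I.take M) = c at hb'
    induction hb' using Submodule.span_induction with
    | mem c hc =>
      obtain ⟨J, rfl⟩ := hc
      rw [← yW_append]
      exact hN _ (by simp; omega)
    | zero => simp
    | add c d _ _ hc hd => rw [add_mul, mul_add]; exact add_mem hc hd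
    | smul k c _ hc => rw [smul_mul_assoc, mul_smul_comm]; exact Submodule.smul_mem _ _ hc
  | add a b ha hb =>
    obtain ⟨N, hN⟩ := ha
    obtain ⟨M, hM⟩ := hb
    refine ⟨max M N, fun I hI => ?_⟩
    rw [map_add, add_mul]
    exact add_mem (hN I (by omega)) (hM I (by omega))

theorem exists_mul_yW_ne_zero {a : Leavitt K n} (ha : a ≠ 0) (N : ℕ) :
    ∃ I : List (Fin n), I.length = N ∧ a * yW K n I ≠ 0 := by
  induction N generalizing a with
  | zero => exact ⟨[], rfl, by simpa [yW] using ha⟩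
  | succ N ih =>
    obtain ⟨j, hj⟩ : ∃ j, a * ly K n j ≠ 0 := by
      by_contra! h
      apply ha
      rw [← mul_one a, ← sum_ly_mul_lx, Finset.mul_sum]
      exact Finset.sum_eq_zero fun j _ => by rw [← mul_assoc, h, zero_mul]
    obtain ⟨I, hI, hI'⟩ := ih hj
    exact ⟨j :: I, by simp [hI], by rwa [yW_cons, ← mul_assoc]⟩

theorem append_replicate_not_prefix {α : Type} {o z : α} (hoz : o ≠ z) {N : ℕ} {I J : List α}
    (hI : I.length ≤ N) (hJ : J.length ≤ N) (hIJ : I ≠ J) :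
    ¬ I ++ (List.replicate N z ++ [o]) <+: J ++ (List.replicate N z ++ [o]) := by
  intro h
  have hle := h.length_le
  simp only [List.length_append, List.length_replicate, List.length_singleton] at hle
  rcases Nat.lt_or_ge I.length J.length with hlt | hge
  · have h1 := List.prefix_iff_getElem?.1 h (I.length + N) (by simp)
    rw [List.getElem?_append_right (by omega), List.getElem?_append_left (by simp; omega)] at h1
    rw [List.getElem_append_right (by omega)] at h1
    simp only [List.getElem?_replicate] at h1
    rw [if_pos (by omega)] at h1
    simp at h1
    exact hoz h1.symm
  · have := h.eq_of_length (by simp; omega)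
    exact hIJ (List.append_cancel_right this)

/-- The Leavitt algebra is simple, in a strong form. -/
theorem exists_mul_mul_eq_one (hn : 2 ≤ n) {a : Leavitt K n} (ha : a ≠ 0) :
    ∃ p q, p * a * q = 1 := by
  obtain ⟨N, hN⟩ := exists_mul_yW_mem_span a
  obtain ⟨I, hI, hI'⟩ := exists_mul_yW_ne_zero ha N
  obtain ⟨c, hc⟩ := Finsupp.mem_span_range_iff_exists_finsupp.1 (hN I hI.ge)
  have hc0 : c ≠ 0 := by rintro rfl; exact hI' (by simpa using hc.symm)
  obtain ⟨J, hJ⟩ := Finsupp.support_nonempty_iff.2 hc0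
  set M := c.support.sup List.length
  have hM : ∀ J ∈ c.support, J.length ≤ M := fun J hJ => Finset.le_sup (f := List.length) hJ
  let w : List (Fin n) := List.replicate M ⟨0, by omega⟩ ++ [⟨1, by omega⟩]
  have h01 : (⟨1, by omega⟩ : Fin n) ≠ ⟨0, by omega⟩ := by simp
  refine ⟨(c J)⁻¹ • xW K n (J ++ w), yW K n I * yW K n w, ?_⟩
  rw [mul_assoc, ← mul_assoc a, ← hc, Finsupp.sum, Finset.sum_mul, Finset.mul_sum,
    Finset.sum_eq_single_of_mem J hJ]
  · rw [smul_mul_assoc, smul_mul_assoc, mul_smul_comm, ← yW_append, xW_mul_yW_self, smul_smul,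
      inv_mul_cancel₀ (Finsupp.mem_support_iff.1 hJ), one_smul]
  · intro L hL hLJ
    rw [smul_mul_assoc, smul_mul_assoc, mul_smul_comm, ← yW_append, xW_mul_yW_of_not_prefix,
      smul_zero, smul_zero]
    · exact append_replicate_not_prefix h01 (hM J hJ) (hM L hL) hLJ.symm
    · exact append_replicate_not_prefix h01 (hM L hL) (hM J hJ) hLJ

theorem leavitt_hom_injective (hn : 2 ≤ n) {S : Type} [Ring S] [Nontrivial S] [Algebra K S]
    (φ : Leavitt K n →ₐ[K] S) : Function.Injective φ := by
  rw [injective_iff_map_eq_zero]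
  intro a ha
  by_contra h
  obtain ⟨p, q, hpq⟩ := exists_mul_mul_eq_one hn h
  simpa [ha] using congrArg φ hpq

end Leavitt

section GraphFamilies

/-- A finite family of pairs `(x, y)` of elements of `S`, labelled by vertices. -/
structure Row (S V : Type) where
  ι : Type
  [fintype : Fintype ι]
  [decEq : DecidableEq ι]
  lab : ι → V
  x : ι → S
  y : ι → S

attribute [instance] Row.fintype Row.decEq

variable {K S V : Type} [Field K] [Ring S] [Algebra K S]

/-- The number of members of a row with a given label. -/
def Row.mult [DecidableEq V] (r : Row S V) (w : V) : ℤ := ∑ i, if r.lab i = w then 1 else 0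

/-- The row implements an isomorphism between `e v` and the direct sum of the `e (lab i)`. -/
structure Row.Splits (e : V → S) (v : V) (r : Row S V) : Prop where
  xy : ∀ i j, r.x i * r.y j = if i = j then e (r.lab i) else 0
  yx : ∑ i, r.y i * r.x i = e v
  ex : ∀ i, e (r.lab i) * r.x i = r.x i
  ye : ∀ i, r.y i * e (r.lab i) = r.y i

theorem Row.Splits.xe {e : V → S} {v : V} {r : Row S V} (h : r.Splits e v) (i : r.ι) :
    r.x i * e v = r.x i := by
  rw [← h.yx, Finset.mul_sum, Finset.sum_eq_single i]
  · rw [← mul_assoc, h.xy, if_pos rfl, h.ex]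
  · intro j _ hj
    rw [← mul_assoc, h.xy, if_neg hj.symm, zero_mul]
  · simp

theorem Row.Splits.ey {e : V → S} {v : V} {r : Row S V} (h : r.Splits e v) (i : r.ι) :
    e v * r.y i = r.y i := by
  rw [← h.yx, Finset.sum_mul, Finset.sum_eq_single i]
  · rw [mul_assoc, h.xy, if_pos rfl, h.ye]
  · intro j _ hj
    rw [mul_assoc, h.xy, if_neg hj, mul_zero]
  · simp

/-- A Leavitt family for a directed graph which generates the algebra `S`. -/
structure IsGenFamily (K : Type) [Field K] [Algebra K S] (e : V → S) (g : V → Row S V) :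
    Prop where
  splits : ∀ v, (g v).Splits e v
  gen : ∀ R : Subalgebra K S, (∀ v, e v ∈ R) → (∀ v i, (g v).x i ∈ R) →
    (∀ v i, (g v).y i ∈ R) → R = ⊤

/-- `S` is generated by a Leavitt family, with vertex idempotents `e`, for the graph whose
adjacency matrix is `B + 1`. -/
def Realizes (K : Type) [Field K] [Algebra K S] [DecidableEq V] (e : V → S)
    (B : V → V → ℤ) : Prop :=
  ∃ g : V → Row S V, IsGenFamily K e g ∧ ∀ v w, (g v).mult w = B v w + if v = w then 1 else 0

theorem exists_sum_equiv [DecidableEq V] {ι κ : Type} [Fintype ι] [Fintype κ]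
    (a : ι → V) (b : κ → V)
    (h : ∀ w, (∑ j, if b j = w then (1 : ℤ) else 0) ≤ ∑ i, if a i = w then 1 else 0) :
    ∃ (ν : Type) (_ : Fintype ν) (_ : DecidableEq ν) (τ : ν ⊕ κ ≃ ι),
      ∀ j, a (τ (Sum.inr j)) = b j := by
  classical
  have hemb : ∀ w, Nonempty ({j // b j = w} ↪ {i // a i = w}) := fun w => by
    rw [Function.Embedding.nonempty_iff_card_le, Fintype.card_subtype, Fintype.card_subtype]
    have := h w
    simp only [Finset.sum_boole] at this
    exact_mod_cast this
  let f : ∀ w, {j // b j = w} ↪ {i // a i = w} := fun w => (hemb w).some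
  let σ : κ → ι := fun j => f (b j) ⟨j, rfl⟩
  have hσ : ∀ j, a (σ j) = b j := fun j => (f (b j) ⟨j, rfl⟩).2
  have key : ∀ w (j : {j // b j = w}), σ j = f w j := by rintro _ ⟨j, rfl⟩; rfl
  have hinj : Function.Injective σ := fun j k hjk => by
    have hb : b j = b k := by rw [← hσ, ← hσ, hjk]
    rw [key (b k) ⟨j, hb⟩, key (b k) ⟨k, rfl⟩] at hjk
    exact congrArg Subtype.val ((f (b k)).injective (Subtype.ext hjk))
  refine ⟨{i // i ∉ Set.range σ}, inferInstance, inferInstance,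
    (Equiv.sumComm _ _).trans (((Equiv.ofInjective σ hinj).sumCongr (Equiv.refl _)).trans
      (Equiv.sumCompl (· ∈ Set.range σ))), fun j => ?_⟩
  simpa using hσ j

variable [DecidableEq V] {e : V → S}

theorem IsGenFamily.update {g : V → Row S V} (hg : IsGenFamily K e g) {v : V} {r : Row S V}
    (hr : r.Splits e v)
    (hgen : ∀ R : Subalgebra K S, (∀ v, e v ∈ R) → (∀ u, u ≠ v → ∀ i, (g u).x i ∈ R) →
      (∀ u, u ≠ v → ∀ i, (g u).y i ∈ R) → (∀ i, r.x i ∈ R) → (∀ i, r.y i ∈ R) →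
      ∀ i, (g v).x i ∈ R ∧ (g v).y i ∈ R) :
    IsGenFamily K e (Function.update g v r) := by
  refine ⟨fun u => ?_, fun R he hx hy => ?_⟩
  · by_cases huv : u = v
    · subst huv; simpa using hr
    · simpa [huv] using hg.splits u
  · have hx' : ∀ u, u ≠ v → ∀ i, (g u).x i ∈ R := fun u hu => by
      have := hx u; rwa [Function.update_of_ne hu] at this
    have hy' : ∀ u, u ≠ v → ∀ i, (g u).y i ∈ R := fun u hu => by
      have := hy u; rwa [Function.update_of_ne hu] at this
    have hxv := hx v
    have hyv := hy v
    rw [Function.update_self] at hxv hyv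
    have := hgen R he hx' hy' hxv hyv
    refine hg.gen R he (fun u i => ?_) (fun u i => ?_)
    · by_cases huv : u = v
      · subst huv; exact (this i).1
      · exact hx' u huv i
    · by_cases huv : u = v
      · subst huv; exact (this i).2
      · exact hy' u huv i

/-- Substituting the relation for `u` into the relation for `v`. -/
theorem Realizes.row_plus {B : V → V → ℤ} (h : Realizes K e B) {u v : V} (huv : v ≠ u)
    (hpos : 1 ≤ B v u) : Realizes K e (Function.update B v (B v + B u)) := by
  obtain ⟨g, hg, hB⟩ := h
  obtain ⟨ν, _, _, τ, hτ⟩ := exists_sum_equiv (g v).lab (fun _ : Unit => u) (fun w => by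
    change _ ≤ (g v).mult w
    by_cases huw : u = w
    · subst huw
      simpa [hB, huv] using hpos
    · simp [huw, Row.mult])
  have hl : (g v).lab (τ (Sum.inr ())) = u := hτ ()
  have hv := hg.splits v
  have hu := hg.splits u
  let r : Row S V :=
    { ι := ν ⊕ (g u).ι
      lab := Sum.elim (fun i => (g v).lab (τ (Sum.inl i))) (g u).lab
      x := Sum.elim (fun i => (g v).x (τ (Sum.inl i)))
        (fun j => (g u).x j * (g v).x (τ (Sum.inr ())))
      y := Sum.elim (fun i => (g v).y (τ (Sum.inl i)))
        (fun j => (g v).y (τ (Sum.inr ())) * (g u).y j) }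
  have hr : r.Splits e v := by
    refine ⟨?_, ?_, ?_, ?_⟩
    · rintro (i | i) (j | j)
      · simp [r, hv.xy]
      · simp [r, ← mul_assoc, hv.xy]
      · simp [r, mul_assoc, hv.xy]
      · simp only [r, Sum.elim_inr, Sum.inr.injEq]
        rw [mul_assoc, ← mul_assoc ((g v).x _), hv.xy, if_pos rfl, hl, hu.ey, hu.xy]
    · rw [← hv.yx, ← Equiv.sum_comp τ]
      simp only [r, Fintype.sum_sum_type, Sum.elim_inl, Sum.elim_inr, Finset.univ_unique,
        Finset.sum_singleton]
      congr 1
      simp_rw [mul_assoc, ← mul_assoc ((g u).y _) ((g u).x _)]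
      rw [← Finset.mul_sum, ← Finset.sum_mul, hu.yx]
      have := hv.ex (τ (Sum.inr ()))
      rw [hl] at this
      exact congrArg _ this
    · rintro (i | i)
      · simp [r, hv.ex]
      · simp [r, ← mul_assoc, hu.ex]
    · rintro (i | i)
      · simp [r, hv.ye]
      · simp [r, mul_assoc, hu.ye]
  refine ⟨Function.update g v r, hg.update hr fun R _ hx hy hrx hry i => ?_, fun a w => ?_⟩
  · obtain ⟨i | i, rfl⟩ := τ.surjective i
    · exact ⟨hrx (Sum.inl i), hry (Sum.inl i)⟩
    · have hex := hv.ex (τ (Sum.inr ()))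
      have hye := hv.ye (τ (Sum.inr ()))
      rw [hl, ← hu.yx] at hex hye
      constructor
      · rw [← hex, Finset.sum_mul]
        refine R.sum_mem fun j _ => ?_
        rw [mul_assoc]
        exact R.mul_mem (hy u huv.symm j) (hrx (Sum.inr j))
      · rw [← hye, Finset.mul_sum]
        refine R.sum_mem fun j _ => ?_
        rw [← mul_assoc]
        exact R.mul_mem (hry (Sum.inr j)) (hx u huv.symm j)
  · by_cases hav : a = v
    · subst hav
      have h1 := hB a w
      have h2 := hB u w
      rw [Row.mult, ← Equiv.sum_comp τ, Fintype.sum_sum_type] at h1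
      simp only [Finset.univ_unique, Finset.sum_singleton, PUnit.default_eq_unit, hl] at h1
      have h3 : r.mult w = (∑ i : ν, if (g a).lab (τ (Sum.inl i)) = w then 1 else 0) +
          (g u).mult w := Fintype.sum_sum_type _
      rw [Function.update_self, Function.update_self, Pi.add_apply, h3]
      linarith
    · simpa [hav] using hB a w

/-- Substituting the relation for `u` backwards into the relation for `v`. -/
theorem Realizes.row_minus {B : V → V → ℤ} (h : Realizes K e B) {u v : V} (huv : v ≠ u)
    (hnn : ∀ w, 0 ≤ B v w - B u w + (if v = w then 1 else 0) - if u = w then 1 else 0) :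
    Realizes K e (Function.update B v (B v - B u)) := by
  obtain ⟨g, hg, hB⟩ := h
  obtain ⟨ν, _, _, τ, hτ⟩ := exists_sum_equiv (g v).lab (g u).lab (fun w => by
    change (g u).mult w ≤ (g v).mult w
    rw [hB, hB]
    linarith [hnn w])
  have hv := hg.splits v
  have hu := hg.splits u
  have hvex : ∀ j, e ((g u).lab j) * (g v).x (τ (Sum.inr j)) = (g v).x (τ (Sum.inr j)) :=
    fun j => by rw [← hτ, hv.ex]
  have hvye : ∀ j, (g v).y (τ (Sum.inr j)) * e ((g u).lab j) = (g v).y (τ (Sum.inr j)) :=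
    fun j => by rw [← hτ, hv.ye]
  let r : Row S V :=
    { ι := ν ⊕ Unit
      lab := Sum.elim (fun i => (g v).lab (τ (Sum.inl i))) (fun _ => u)
      x := Sum.elim (fun i => (g v).x (τ (Sum.inl i)))
        (fun _ => ∑ j, (g u).y j * (g v).x (τ (Sum.inr j)))
      y := Sum.elim (fun i => (g v).y (τ (Sum.inl i)))
        (fun _ => ∑ j, (g v).y (τ (Sum.inr j)) * (g u).x j) }
  have hxr : ∀ j, (g u).x j * r.x (Sum.inr ()) = (g v).x (τ (Sum.inr j)) := fun j => by
    simp only [r, Sum.elim_inr, Finset.mul_sum, ← mul_assoc, hu.xy, ite_mul, zero_mul,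
      Finset.sum_ite_eq, Finset.mem_univ, if_true, hvex]
  have hyr : ∀ j, r.y (Sum.inr ()) * (g u).y j = (g v).y (τ (Sum.inr j)) := fun j => by
    simp only [r, Sum.elim_inr, Finset.sum_mul, mul_assoc, hu.xy, mul_ite, mul_zero,
      Finset.sum_ite_eq', Finset.mem_univ, if_true, hvye]
  have hr : r.Splits e v := by
    refine ⟨?_, ?_, ?_, ?_⟩
    · rintro (i | i) (j | j)
      · simp [r, hv.xy]
      · simp [r, Finset.mul_sum, ← mul_assoc, hv.xy]
      · simp [r, Finset.sum_mul, mul_assoc, hv.xy]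
      · rw [if_pos rfl]
        change _ = e u
        rw [← hu.yx]
        change (∑ j, (g u).y j * (g v).x (τ (Sum.inr j))) * _ = _
        rw [Finset.sum_mul]
        refine Finset.sum_congr rfl fun j _ => ?_
        change _ * ∑ k, (g v).y (τ (Sum.inr k)) * (g u).x k = _
        simp only [Finset.mul_sum, mul_assoc]
        rw [Finset.sum_eq_single j]
        · rw [← mul_assoc ((g v).x _), hv.xy, if_pos rfl, hτ, hu.ex]
        · intro k _ hk
          rw [← mul_assoc ((g v).x _), hv.xy, if_neg (by simpa using hk.symm)]
          simp
        · simp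
    · rw [← hv.yx, ← Equiv.sum_comp τ]
      rw [Fintype.sum_sum_type, Fintype.sum_sum_type]
      congr 1
      rw [Finset.univ_unique, Finset.sum_singleton]
      change (∑ j, (g v).y (τ (Sum.inr j)) * (g u).x j) * _ = _
      rw [Finset.sum_mul]
      refine Finset.sum_congr rfl fun j _ => ?_
      rw [mul_assoc]
      exact congrArg _ (hxr j)
    · rintro (i | i)
      · simp [r, hv.ex]
      · simp [r, Finset.mul_sum, ← mul_assoc, hu.ey]
    · rintro (i | i)
      · simp [r, hv.ye]
      · simp [r, Finset.sum_mul, mul_assoc, hu.xe]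
  refine ⟨Function.update g v r, hg.update hr fun R _ hx hy hrx hry i => ?_, fun a w => ?_⟩
  · obtain ⟨i | i, rfl⟩ := τ.surjective i
    · exact ⟨hrx (Sum.inl i), hry (Sum.inl i)⟩
    · rw [← hxr, ← hyr]
      exact ⟨R.mul_mem (hx u huv.symm i) (hrx _), R.mul_mem (hry _) (hy u huv.symm i)⟩
  · by_cases hav : a = v
    · subst hav
      have h1 := hB a w
      have h2 := hB u w
      rw [Row.mult, ← Equiv.sum_comp τ, Fintype.sum_sum_type] at h1
      simp only [hτ] at h1
      change _ + (g u).mult w = _ at h1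
      have h3 : r.mult w = (∑ i : ν, if (g a).lab (τ (Sum.inl i)) = w then 1 else 0) +
          (if u = w then 1 else 0) :=
        (Fintype.sum_sum_type _).trans (congrArg _ (Fintype.sum_unique _))
      rw [Function.update_self, Function.update_self, Pi.sub_apply, h3]
      linarith
    · simpa [hav] using hB a w

theorem sum_subtype_eq_sum_ite {α M : Type} [Fintype α] [AddCommMonoid M] (P : α → Prop)
    [DecidablePred P] (f : α → M) : ∑ q : {q // P q}, f q = ∑ q, if P q then f q else 0 := by
  rw [← Finset.sum_filter]
  exact (Finset.sum_subtype _ (by simp) f).symm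

/-- Splitting vertices according to a partition of the corresponding rows. -/
theorem IsGenFamily.exists_outsplit {W : Type} [Fintype V] [Fintype W] [DecidableEq W]
    (he : CompleteOrthogonalIdempotents e) {g : V → Row S V} (hg : IsGenFamily K e g)
    (π : W → V) (p : ∀ v, (g v).ι → W) (hp : ∀ v i, π (p v i) = v) :
    ∃ e' : W → S, CompleteOrthogonalIdempotents e' ∧ ∃ g' : W → Row S W, IsGenFamily K e' g' ∧
      ∀ v w, (g' v).mult w =
        ∑ i, if p (π v) i = v ∧ (g (π v)).lab i = π w then 1 else 0 := by
  have hs := hg.splits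
  let E : V → W → S := fun v w => ∑ i, if p v i = w then (g v).y i * (g v).x i else 0
  have hE0 : ∀ v w, π w ≠ v → E v w = 0 := fun v w hvw =>
    Finset.sum_eq_zero fun i _ => if_neg fun h => hvw (by rw [← h, hp])
  have hEsum : ∀ v, ∑ w, E v w = e v := fun v => by
    rw [Finset.sum_comm, ← (hs v).yx]
    simp
  have heE : ∀ v w, e v * E v w = E v w := fun v w => by
    simp only [E, Finset.mul_sum, mul_ite, mul_zero, ← mul_assoc, (hs v).ey]
  have hEe : ∀ v w, E v w * e v = E v w := fun v w => by
    simp only [E, Finset.sum_mul, ite_mul, zero_mul, mul_assoc, (hs v).xe]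
  have hyxE : ∀ v w i, (g v).x i * E v w = if p v i = w then (g v).x i else 0 := fun v w i => by
    simp only [E, Finset.mul_sum, mul_ite, mul_zero, ← mul_assoc, (hs v).xy, ite_mul, zero_mul]
    rw [Finset.sum_eq_single i]
    · simp [(hs v).ex]
    · simp +contextual [eq_comm]
    · simp
  have hEE : ∀ v w w', E v w * E v w' = if w = w' then E v w else 0 := fun v w w' => by
    change (∑ i, if p v i = w then (g v).y i * (g v).x i else 0) * _ = _
    simp_rw [Finset.sum_mul, ite_mul, zero_mul, mul_assoc, hyxE]
    by_cases h : w = w'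
    · subst h
      rw [if_pos rfl]
      exact Finset.sum_congr rfl fun i _ => by split_ifs <;> rfl
    · rw [if_neg h]
      refine Finset.sum_eq_zero fun i _ => ?_
      split_ifs with h1 h2
      · exact absurd (h1.symm.trans h2) h
      · exact mul_zero _
      · rfl
  have hEE0 : ∀ v v' w w', v ≠ v' → E v w * E v' w' = 0 := fun v v' w w' hv => by
    rw [← hEe v, ← heE v', mul_assoc, ← mul_assoc (e v), he.ortho hv, zero_mul, mul_zero]
  have he' : CompleteOrthogonalIdempotents fun w => E (π w) w := by
    refine ⟨⟨fun w => ?_, fun w w' hww => ?_⟩, ?_⟩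
    · change E _ _ * E _ _ = _
      rw [hEE, if_pos rfl]
    · change E (π w) w * E (π w') w' = 0
      by_cases h : π w = π w'
      · rw [h, hEE, if_neg hww]
      · exact hEE0 _ _ _ _ h
    · rw [← he.complete]
      simp_rw [← hEsum]
      rw [Finset.sum_comm]
      refine Finset.sum_congr rfl fun w _ => ?_
      rw [Finset.sum_eq_single (π w)]
      · exact fun v _ hv => hE0 v w hv.symm
      · simp
  let g' : W → Row S W := fun v =>
    { ι := {q : (g (π v)).ι × W // p (π v) q.1 = v ∧ (g (π v)).lab q.1 = π q.2}
      lab := fun q => q.1.2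
      x := fun q => E (π q.1.2) q.1.2 * (g (π v)).x q.1.1
      y := fun q => (g (π v)).y q.1.1 * E (π q.1.2) q.1.2 }
  have hg' : ∀ v, (g' v).Splits (fun w => E (π w) w) v := fun v => by
    refine ⟨?_, ?_, ?_, ?_⟩
    · rintro ⟨⟨i, w⟩, hi, hw⟩ ⟨⟨j, w'⟩, hj, hw'⟩
      dsimp only [g'] at *
      rw [mul_assoc, ← mul_assoc _ ((g (π v)).y j), (hs _).xy]
      by_cases hij : i = j
      · subst hij
        have hww : π w = π w' := hw.symm.trans hw'
        have he'' : e ((g (π v)).lab i) = e (π w') := congrArg e hw'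
        have hE : E (π w) w * E (π w') w' = if w = w' then E (π w) w else 0 := by
          rw [hww, hEE]
        rw [if_pos rfl, he'', heE, hE]
        simp
      · simp [hij]
    · change ∑ q : {q : (g (π v)).ι × W // _}, _ = _
      rw [sum_subtype_eq_sum_ite (fun q : (g (π v)).ι × W =>
        p (π v) q.1 = v ∧ (g (π v)).lab q.1 = π q.2) (fun q =>
        ((g (π v)).y q.1 * E (π q.2) q.2) * (E (π q.2) q.2 * (g (π v)).x q.1)),
        Fintype.sum_prod_type]
      refine Finset.sum_congr rfl fun i _ => ?_
      dsimp only
      split_ifs with h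
      · conv_rhs => rw [← (hs (π v)).ex i, ← hEsum, Finset.sum_mul, Finset.mul_sum]
        refine Finset.sum_congr rfl fun w _ => ?_
        split_ifs with h2
        · rw [← h2.2, mul_assoc, ← mul_assoc (E _ _), hEE, if_pos rfl]
        · rw [hE0 _ _ fun h3 => h2 ⟨h, h3.symm⟩, zero_mul, mul_zero]
      · exact Finset.sum_eq_zero fun w _ => if_neg fun h2 => h h2.1
    · rintro ⟨⟨i, w⟩, hi, hw⟩
      dsimp only [g']
      rw [← mul_assoc, hEE, if_pos rfl]
    · rintro ⟨⟨i, w⟩, hi, hw⟩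
      dsimp only [g']
      rw [mul_assoc, hEE, if_pos rfl]
  refine ⟨_, he', g', ⟨hg', fun R hRe hRx hRy => ?_⟩, fun v w => ?_⟩
  · have hER : ∀ v w, E v w ∈ R := fun v w => by
      by_cases h : π w = v
      · exact h ▸ hRe w
      · rw [hE0 _ _ h]; exact R.zero_mem
    refine hg.gen R (fun v => ?_) (fun v i => ?_) (fun v i => ?_)
    · rw [← hEsum]
      exact R.sum_mem fun w _ => hER v w
    · rw [← (hs v).ex, ← hEsum, Finset.sum_mul]
      refine R.sum_mem fun w _ => ?_
      obtain ⟨v', rfl, hv'⟩ : ∃ v', v = π v' ∧ p v i = v' := ⟨_, (hp v i).symm, rfl⟩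
      by_cases h : (g (π v')).lab i = π w
      · rw [h]; exact hRx v' ⟨(i, w), hv', h⟩
      · rw [hE0 _ _ (Ne.symm h), zero_mul]; exact R.zero_mem
    · rw [← (hs v).ye, ← hEsum, Finset.mul_sum]
      refine R.sum_mem fun w _ => ?_
      obtain ⟨v', rfl, hv'⟩ : ∃ v', v = π v' ∧ p v i = v' := ⟨_, (hp v i).symm, rfl⟩
      by_cases h : (g (π v')).lab i = π w
      · rw [h]; exact hRy v' ⟨(i, w), hv', h⟩
      · rw [hE0 _ _ (Ne.symm h), mul_zero]; exact R.zero_mem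
  · change ∑ q : {q : (g (π v)).ι × W // _}, _ = _
    rw [sum_subtype_eq_sum_ite (fun q : (g (π v)).ι × W =>
      p (π v) q.1 = v ∧ (g (π v)).lab q.1 = π q.2) (fun q => if q.2 = w then (1 : ℤ) else 0),
      Fintype.sum_prod_type]
    refine Finset.sum_congr rfl fun i _ => ?_
    rw [Finset.sum_eq_single w] <;> simp +contextual

/-- If every vertex `v` decomposes as `c v` copies of the unit, then the generating family is
equivalent to a Leavitt family with `∑ c v` members. -/
theorem Realizes.exists_leavitt_surjective [Fintype V] (he : CompleteOrthogonalIdempotents e)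
    (c : V → ℕ) {n : ℕ} (hc : ∑ v, c v = n)
    (h : Realizes K e fun v w => c v - if v = w then 1 else 0) :
    ∃ φ : Leavitt K n →ₐ[K] S, Function.Surjective φ := by
  obtain ⟨g, hg, hB⟩ := h
  have hs := hg.splits
  have hτ : ∀ v, ∃ τ : (Fin (c v) × V) ≃ (g v).ι, ∀ q, (g v).lab (τ q) = q.2 := fun v => by
    have hf : ∀ w, Nonempty ({i // (g v).lab i = w} ≃ Fin (c v)) := fun w => by
      refine ⟨Fintype.equivFinOfCardEq ?_⟩
      have := hB v w
      simp only [Row.mult, Finset.sum_boole, sub_add_cancel] at this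
      rw [Fintype.card_subtype]
      exact_mod_cast this
    let f := fun w => (hf w).some
    refine ⟨(Equiv.prodComm _ _).trans ((Equiv.sigmaEquivProd _ _).symm.trans
      ((Equiv.sigmaCongrRight fun w => (f w).symm).trans (Equiv.sigmaFiberEquiv (g v).lab))), ?_⟩
    rintro ⟨t, w⟩
    exact ((f w).symm t).2
  choose τ hτ using hτ
  have horth : ∀ v w, e v * e w = if v = w then e v else 0 := he.toOrthogonalIdempotents.mul_eq
  let X : (Σ v, Fin (c v)) → S := fun s => ∑ w, (g s.1).x (τ s.1 (s.2, w))
  let Y : (Σ v, Fin (c v)) → S := fun s => ∑ w, (g s.1).y (τ s.1 (s.2, w))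
  have heX : ∀ v t w, e w * X ⟨v, t⟩ = (g v).x (τ v (t, w)) := fun v t w => by
    simp only [X, Finset.mul_sum]
    rw [Finset.sum_eq_single w]
    · simpa [hτ] using (hs v).ex (τ v (t, w))
    · intro w' _ hw
      rw [← (hs v).ex, hτ, ← mul_assoc, horth, if_neg hw.symm, zero_mul]
    · simp
  have hYe : ∀ v t w, Y ⟨v, t⟩ * e w = (g v).y (τ v (t, w)) := fun v t w => by
    simp only [Y, Finset.sum_mul]
    rw [Finset.sum_eq_single w]
    · simpa [hτ] using (hs v).ye (τ v (t, w))
    · intro w' _ hw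
      rw [← (hs v).ye, hτ, mul_assoc, horth, if_neg hw, mul_zero]
    · simp
  have hXY : ∀ s s', X s * Y s' = if s = s' then 1 else 0 := by
    rintro ⟨v, t⟩ ⟨v', t'⟩
    by_cases hv : v = v'
    · subst hv
      simp only [X, Y, Finset.sum_mul, Finset.mul_sum, (hs v).xy, hτ, EmbeddingLike.apply_eq_iff_eq,
        Prod.mk.injEq, Sigma.mk.injEq, true_and, heq_eq_eq]
      by_cases ht : t = t' <;> simp [ht, he.complete]
    · rw [if_neg (by simp [hv])]
      simp only [X, Y, Finset.sum_mul, Finset.mul_sum]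
      refine Finset.sum_eq_zero fun w _ => Finset.sum_eq_zero fun w' _ => ?_
      rw [← (hs v).xe, ← (hs v').ey, mul_assoc, ← mul_assoc (e v), horth, if_neg hv, zero_mul,
        mul_zero]
  have hYX : ∀ v, ∑ t, Y ⟨v, t⟩ * X ⟨v, t⟩ = e v := fun v => by
    rw [← (hs v).yx, ← Equiv.sum_comp (τ v), Fintype.sum_prod_type]
    refine Finset.sum_congr rfl fun t _ => ?_
    change (∑ w, (g v).y (τ v (t, w))) * _ = _
    rw [Finset.sum_mul]
    refine Finset.sum_congr rfl fun w _ => ?_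
    rw [← heX, ← mul_assoc]
    have := (hs v).ye (τ v (t, w))
    rw [hτ] at this
    rw [this]
  let σ : Fin n ≃ Σ v, Fin (c v) := (Fintype.equivFinOfCardEq (by simp [hc])).symm
  obtain ⟨φ, hφX, hφY⟩ := exists_leavittLift (K := K) (fun i => X (σ i)) (fun i => Y (σ i))
    (fun i j => by simp [hXY])
    (by rw [Equiv.sum_comp σ fun s => Y s * X s, Fintype.sum_sigma, ← he.complete]; simp [hYX])
  refine ⟨φ, (AlgHom.range_eq_top φ).1 ?_⟩
  have hX : ∀ s, X s ∈ φ.range := fun s => ⟨lx K n (σ.symm s), by simpa using hφX (σ.symm s)⟩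
  have hY : ∀ s, Y s ∈ φ.range := fun s => ⟨ly K n (σ.symm s), by simpa using hφY (σ.symm s)⟩
  have hRe : ∀ v, e v ∈ φ.range := fun v => by
    rw [← hYX]
    exact Subalgebra.sum_mem _ fun t _ => Subalgebra.mul_mem _ (hY _) (hX _)
  refine hg.gen _ hRe (fun v i => ?_) (fun v i => ?_)
  · obtain ⟨⟨t, w⟩, rfl⟩ := (τ v).surjective i
    rw [← heX]
    exact Subalgebra.mul_mem _ (hRe w) (hX _)
  · obtain ⟨⟨t, w⟩, rfl⟩ := (τ v).surjective i
    rw [← hYe]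
    exact Subalgebra.mul_mem _ (hY _) (hRe w)

end GraphFamilies

/-- The matrix algebra of size `k + 1` is generated by a Leavitt family for a graph with two
vertices, the second of which emits `k` arrows, all to the first one. -/
theorem exists_realizes_matrix (K : Type) [Field K] (n k : ℕ) :
    ∃ e : Fin 2 → Matrix (Fin (k + 1)) (Fin (k + 1)) (Leavitt K n),
      CompleteOrthogonalIdempotents e ∧ Realizes K e ![![n - 1, 0], ![k, -1]] := by
  let S := Matrix (Fin (k + 1)) (Fin (k + 1)) (Leavitt K n)
  let e : Fin 2 → S := ![Matrix.single 0 0 1, ∑ j : Fin k, Matrix.single j.succ j.succ 1]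
  let r₀ : Row S (Fin 2) :=
    { ι := Fin n, lab := fun _ => 0, x := fun i => Matrix.single 0 0 (lx K n i),
      y := fun i => Matrix.single 0 0 (ly K n i) }
  let r₁ : Row S (Fin 2) :=
    { ι := Fin k, lab := fun _ => 0, x := fun i => Matrix.single 0 i.succ 1,
      y := fun i => Matrix.single i.succ 0 1 }
  have hsingle : ∀ (a b c d : Fin (k + 1)) (s t : Leavitt K n),
      Matrix.single a b s * Matrix.single c d t =
        if b = c then Matrix.single a d (s * t) else 0 := fun a b c d s t => by
    split_ifs with h
    · rw [h, Matrix.single_mul_single_same]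
    · exact Matrix.single_mul_single_of_ne _ _ _ _ h _
  have h₀ : r₀.Splits e 0 := by
    refine ⟨fun (i j : Fin n) => ?_, ?_, fun (i : Fin n) => ?_, fun (i : Fin n) => ?_⟩
    · change Matrix.single 0 0 (lx K n i) * Matrix.single 0 0 (ly K n j) =
        if i = j then Matrix.single 0 0 1 else 0
      rw [hsingle, if_pos rfl, lx_mul_ly]
      split_ifs <;> simp
    · change ∑ i : Fin n, Matrix.single 0 0 (ly K n i) * Matrix.single 0 0 (lx K n i) =
        Matrix.single 0 0 1
      simp_rw [hsingle, if_pos]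
      refine (map_sum (Matrix.singleAddMonoidHom (α := Leavitt K n) (0 : Fin (k + 1))
        (0 : Fin (k + 1))) (fun i => ly K n i * lx K n i) Finset.univ).symm.trans ?_
      rw [sum_ly_mul_lx]
      rfl
    · exact (hsingle ..).trans (by rw [if_pos rfl, one_mul])
    · exact (hsingle ..).trans (by rw [if_pos rfl, mul_one])
  have h₁ : r₁.Splits e 1 := by
    refine ⟨fun (i j : Fin k) => ?_, ?_, fun (i : Fin k) => ?_, fun (i : Fin k) => ?_⟩
    · change Matrix.single 0 i.succ 1 * Matrix.single j.succ 0 1 =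
        if i = j then Matrix.single 0 0 1 else 0
      rw [hsingle]
      simp
    · change ∑ i : Fin k, Matrix.single i.succ 0 1 * Matrix.single 0 i.succ 1 =
        ∑ j : Fin k, Matrix.single j.succ j.succ 1
      simp [hsingle]
    · exact (hsingle ..).trans (by rw [if_pos rfl, one_mul])
    · exact (hsingle ..).trans (by rw [if_pos rfl, mul_one])
  refine ⟨e, ⟨⟨?_, ?_⟩, ?_⟩, ![r₀, r₁], ⟨Fin.forall_fin_two.2 ⟨h₀, h₁⟩, fun R he hx hy => ?_⟩, ?_⟩
  · rw [Fin.forall_fin_two]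
    constructor <;> simp [e, IsIdempotentElem, hsingle, Finset.sum_mul, Finset.mul_sum]
  · intro v w hvw
    fin_cases v <;> fin_cases w
    · exact absurd rfl hvw
    · simp [e, hsingle, Finset.mul_sum, (Fin.succ_ne_zero _).symm]
    · simp [e, hsingle, Finset.sum_mul]
    · exact absurd rfl hvw
  · rw [Fin.sum_univ_two]
    change Matrix.single 0 0 1 + ∑ j : Fin k, Matrix.single j.succ j.succ 1 = 1
    rw [← Fin.sum_univ_succ fun j => Matrix.single j j (1 : Leavitt K n)]
    ext i j
    simp [Matrix.sum_apply, Matrix.single_apply, Matrix.one_apply, ite_and]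
  · let R₀ : Subalgebra K (Leavitt K n) :=
      { carrier := {a | Matrix.single 0 0 a ∈ R}
        mul_mem' := fun {a b} ha hb => by
          have := R.mul_mem ha hb
          rwa [hsingle, if_pos rfl] at this
        add_mem' := fun {a b} ha hb => by
          have := R.add_mem ha hb
          rwa [← Matrix.single_add] at this
        algebraMap_mem' := fun c => by
          have := R.smul_mem (he 0) c
          rw [Algebra.algebraMap_eq_smul_one]
          change Matrix.single 0 0 (c • (1 : Leavitt K n)) ∈ R
          rw [← Matrix.smul_single]
          exact this }
    have hR₀ : R₀ = ⊤ := leavitt_subalgebra_eq_top R₀ (fun i => hx 0 i) fun i => hy 0 i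
    have hR : ∀ a, Matrix.single 0 0 a ∈ R := fun a => by
      have : a ∈ R₀ := hR₀ ▸ Algebra.mem_top
      exact this
    have hc : ∀ i, Matrix.single i 0 1 ∈ R := Fin.cases (he 0) fun i => hy 1 i
    have hr : ∀ i, Matrix.single 0 i 1 ∈ R := Fin.cases (he 0) fun i => hx 1 i
    rw [eq_top_iff]
    rintro M -
    rw [Matrix.matrix_eq_sum_single M]
    refine R.sum_mem fun i _ => R.sum_mem fun j _ => ?_
    have := R.mul_mem (R.mul_mem (hc i) (hR (M i j))) (hr j)
    rwa [hsingle, if_pos rfl, hsingle, if_pos rfl, one_mul, mul_one] at this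
  · have hn : r₀.mult 0 = n := by simp [Row.mult, r₀]
    have hk : r₁.mult 0 = k := by simp [Row.mult, r₁]
    have hn' : r₀.mult 1 = 0 := by simp [Row.mult, r₀]
    have hk' : r₁.mult 1 = 0 := by simp [Row.mult, r₁]
    simp [Fin.forall_fin_two, hn, hk, hn', hk']

section Moves

variable {K S V : Type} [Field K] [Ring S] [Algebra K S] [DecidableEq V] {e : V → S}

/-- Adding any multiple of a nonnegative row, as long as the result stays positive. -/
theorem Realizes.row_add_zsmul {B : V → V → ℤ} (h : Realizes K e B) {u v : V} (huv : v ≠ u)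
    (hu : ∀ w, 0 ≤ B u w) (hv : ∀ w, 1 ≤ B v w + if v = w then 1 else 0) (N : ℤ)
    (hN : ∀ w, 1 ≤ B v w + N * B u w + if v = w then 1 else 0) :
    Realizes K e (Function.update B v (B v + N • B u)) := by
  have up : ∀ k : ℕ, Realizes K e (Function.update B v (B v + k • B u)) := fun k => by
    induction k with
    | zero => simpa using h
    | succ k ih =>
      have h1 := hv u
      rw [if_neg huv] at h1
      convert ih.row_plus huv ?_ using 1
      · simp [huv.symm, add_smul, add_assoc]
      · simp only [Function.update_self, Pi.add_apply, nsmul_eq_mul, Pi.mul_apply,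
          Pi.natCast_apply]
        have := mul_nonneg (Nat.cast_nonneg (α := ℤ) k) (hu u)
        linarith
  have down : ∀ k : ℕ, Realizes K e (Function.update B v (B v + (N + k) • B u)) →
      Realizes K e (Function.update B v (B v + N • B u)) := fun k => by
    induction k with
    | zero => intro h; simpa using h
    | succ k ih =>
      intro h
      refine ih ?_
      convert h.row_minus huv ?_ using 1
      · simp [huv.symm, add_smul, add_sub_assoc]
      · intro w
        simp only [Function.update_self, Function.update_of_ne huv.symm, Pi.add_apply,
          Pi.smul_apply, smul_eq_mul]
        have h1 := hN w
        have h2 := mul_nonneg (Nat.cast_nonneg (α := ℤ) k) (hu w)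
        have h3 : (if u = w then 1 else 0 : ℤ) ≤ 1 := by split_ifs <;> simp
        push_cast
        linarith
  refine down (N.natAbs - N).toNat ?_
  convert up (N.natAbs) using 3
  rw [← natCast_zsmul]
  congr 1
  omega

/-- Up to adding multiples of the row `u` to the other rows, the matrix `B` is realized by a matrix
whose rows other than `u` are positive, except that a diagonal entry may vanish. -/
def RealizesMod (K : Type) [Field K] [Algebra K S] (e : V → S) (u : V) (B : V → V → ℤ) : Prop :=
  ∃ B' : V → V → ℤ, Realizes K e B' ∧ B' u = B u ∧ ∀ v, v ≠ u →
    (∀ w, 1 ≤ B' v w + if v = w then 1 else 0) ∧ ∃ N : ℤ, B' v = B v + N • B u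

theorem RealizesMod.row_plus {u : V} {B : V → V → ℤ} (h : RealizesMod K e u B) {v w : V}
    (hvw : v ≠ w) (hvu : v ≠ u) (hwu : w ≠ u) :
    RealizesMod K e u (Function.update B v (B v + B w)) := by
  obtain ⟨B', hB, hu, hB'⟩ := h
  obtain ⟨hv, N, hN⟩ := hB' v hvu
  obtain ⟨hw, M, hM⟩ := hB' w hwu
  refine ⟨_, hB.row_plus hvw (by simpa [hvw] using hv w), by simp [hvu.symm, hu], fun x hx => ?_⟩
  by_cases hxv : x = v
  · subst hxv
    refine ⟨fun y => ?_, N + M, ?_⟩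
    · have h1 := hv y
      have h2 := hw y
      have h3 : (if w = y then 1 else 0 : ℤ) ≤ 1 := by split_ifs <;> simp
      simp only [Function.update_self, Pi.add_apply]
      linarith
    · simp only [Function.update_self, Function.update_of_ne hvu.symm, hN, hM]
      module
  · simpa [hxv, hvu.symm] using hB' x hx

theorem RealizesMod.row_minus [Fintype V] {u : V} {B : V → V → ℤ} (h : RealizesMod K e u B)
    (hpos : ∀ w, 1 ≤ B u w) {v w : V} (hvw : v ≠ w) (hvu : v ≠ u) (hwu : w ≠ u) :
    RealizesMod K e u (Function.update B v (B v - B w)) := by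
  obtain ⟨B', hB, hu, hB'⟩ := h
  obtain ⟨hv, N, hN⟩ := hB' v hvu
  obtain ⟨hw, M, hM⟩ := hB' w hwu
  obtain ⟨k, hk⟩ : ∃ k : ℕ, ∀ y, B' w y + 1 ≤ B' v y + k * B' u y := by
    refine ⟨∑ y, (B' w y + 1 - B' v y).natAbs, fun y => ?_⟩
    have h1 := Finset.single_le_sum (f := fun y => (B' w y + 1 - B' v y).natAbs)
      (fun _ _ => Nat.zero_le _) (Finset.mem_univ y)
    have h2 := hpos y
    rw [← hu] at h2
    have h3 : (B' w y + 1 - B' v y) ≤ ((∑ y, (B' w y + 1 - B' v y).natAbs : ℕ) : ℤ) := by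
      omega
    nlinarith
  have hδ : ∀ x y : V, (0 : ℤ) ≤ (if x = y then 1 else 0) ∧ (if x = y then 1 else 0 : ℤ) ≤ 1 :=
    fun x y => by split_ifs <;> simp
  have h1 := hB.row_add_zsmul hvu (fun y => by rw [hu]; linarith [hpos y]) hv k fun y => by
    linarith [hk y, hw y, hδ w y, hδ v y]
  have h2 := h1.row_minus hvw fun y => by
    simp only [Function.update_self, Function.update_of_ne hvw.symm, Pi.add_apply, Pi.smul_apply,
      smul_eq_mul]
    linarith [hk y, hδ w y, hδ v y]
  simp only [Function.update_self, Function.update_of_ne hvw.symm, Function.update_idem] at h2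
  refine ⟨_, h2, by simp [hvu.symm, hu], fun x hx => ?_⟩
  by_cases hxv : x = v
  · subst hxv
    refine ⟨fun y => ?_, N + k - M, ?_⟩
    · simp only [Function.update_self, Pi.add_apply, Pi.sub_apply, Pi.smul_apply, smul_eq_mul]
      linarith [hk y, hδ x y]
    · simp only [Function.update_self, Function.update_of_ne hvu.symm, hN, hM, hu]
      module
  · simpa [hxv, hvu.symm] using hB' x hx

end Moves

section ThreeVertices

variable {K S : Type} [Field K] [Ring S] [Algebra K S]

section

variable {e : Fin 3 → S} {f g R : Fin 3 → ℤ}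

theorem update_vecCons_zero {α : Type} (a b c x : α) :
    Function.update ![a, b, c] 0 x = ![x, b, c] := by
  ext i; fin_cases i <;> rfl

theorem update_vecCons_one {α : Type} (a b c x : α) :
    Function.update ![a, b, c] 1 x = ![a, x, c] := by
  ext i; fin_cases i <;> rfl

theorem update_vecCons_two {α : Type} (a b c x : α) :
    Function.update ![a, b, c] 2 x = ![a, b, x] := by
  ext i; fin_cases i <;> rfl

theorem RealizesMod.add_left (h : RealizesMod K e 2 ![f, g, R]) :
    RealizesMod K e 2 ![f + g, g, R] := by
  simpa [update_vecCons_zero] using h.row_plus (v := 0) (w := 1) (by decide) (by decide) (by decide)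

theorem RealizesMod.add_right (h : RealizesMod K e 2 ![f, g, R]) :
    RealizesMod K e 2 ![f, g + f, R] := by
  simpa [update_vecCons_one] using h.row_plus (v := 1) (w := 0) (by decide) (by decide) (by decide)

theorem RealizesMod.sub_left (hR : ∀ w, 1 ≤ R w) (h : RealizesMod K e 2 ![f, g, R]) :
    RealizesMod K e 2 ![f - g, g, R] := by
  simpa [update_vecCons_zero] using
    h.row_minus hR (v := 0) (w := 1) (by decide) (by decide) (by decide)

theorem RealizesMod.sub_right (hR : ∀ w, 1 ≤ R w) (h : RealizesMod K e 2 ![f, g, R]) :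
    RealizesMod K e 2 ![f, g - f, R] := by
  simpa [update_vecCons_one] using
    h.row_minus hR (v := 1) (w := 0) (by decide) (by decide) (by decide)

/-- `SL₂(ℤ)` acts on the first two rows. -/
theorem RealizesMod.specialLinearGroup_smul (hR : ∀ w, 1 ≤ R w)
    (A : Matrix.SpecialLinearGroup (Fin 2) ℤ) :
    ∀ {f g : Fin 3 → ℤ}, RealizesMod K e 2 ![f, g, R] →
      RealizesMod K e 2 ![A 0 0 • f + A 0 1 • g, A 1 0 • f + A 1 1 • g, R] := by
  let P : Matrix.SpecialLinearGroup (Fin 2) ℤ → Prop := fun A =>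
    ∀ f g : Fin 3 → ℤ, RealizesMod K e 2 ![f, g, R] →
      RealizesMod K e 2 ![A 0 0 • f + A 0 1 • g, A 1 0 • f + A 1 1 • g, R]
  have hmul : ∀ A B, P A → P B → P (A * B) := fun A B hA hB f g h => by
    convert hA _ _ (hB f g h) using 2
    · simp only [Matrix.SpecialLinearGroup.coe_mul, Matrix.mul_apply, Fin.sum_univ_two]
      module
    · simp only [Matrix.SpecialLinearGroup.coe_mul, Matrix.mul_apply, Fin.sum_univ_two]
      congr 1
      module
  have key : P A ∧ P A⁻¹ := by
    have hA : A ∈ Subgroup.closure {ModularGroup.S, ModularGroup.T} := by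
      rw [SpecialLinearGroup.SL2Z_generators]; trivial
    induction hA using Subgroup.closure_induction with
    | mem A hA =>
      obtain rfl | rfl := hA
      · refine ⟨fun f g h => ?_, fun f g h => ?_⟩
        · simpa [ModularGroup.S] using ((h.sub_left hR).add_right).sub_left hR
        · rw [Matrix.SpecialLinearGroup.SL2_inv_expl]
          simpa [ModularGroup.S] using (h.add_left.sub_right hR).add_left
      · refine ⟨fun f g h => ?_, fun f g h => ?_⟩
        · simpa [ModularGroup.T] using h.add_left
        · rw [Matrix.SpecialLinearGroup.SL2_inv_expl]
          simpa [ModularGroup.T, ← sub_eq_add_neg] using h.sub_left hR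
    | one => constructor <;> intro f g h <;> simpa using h
    | mul A B _ _ hA hB => exact ⟨hmul A B hA.1 hB.1, mul_inv_rev A B ▸ hmul _ _ hB.2 hA.2⟩
    | inv A _ hA => exact ⟨hA.2, (inv_inv A).symm ▸ hA.1⟩
  exact fun {f g} h => key.1 f g h

theorem RealizesMod.realizes (hR : ∀ w, 1 ≤ R w) (h : RealizesMod K e 2 ![f, g, R]) (N M : ℤ)
    (hf : ∀ w, 1 ≤ f w + N * R w + if 0 = w then 1 else 0)
    (hg : ∀ w, 1 ≤ g w + M * R w + if 1 = w then 1 else 0) :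
    Realizes K e ![f + N • R, g + M • R, R] := by
  obtain ⟨B, hB, h2, hB'⟩ := h
  obtain ⟨h0, N', hN'⟩ := hB' 0 (by decide)
  obtain ⟨h1, M', hM'⟩ := hB' 1 (by decide)
  simp only [Matrix.cons_val] at h2 hN' hM'
  obtain rfl : B = ![f + N' • R, g + M' • R, R] := by
    ext i; fin_cases i <;> simp [h2, hN', hM']
  have hR' : ∀ w, 0 ≤ R w := fun w => zero_le_one.trans (hR w)
  have hB1 := hB.row_add_zsmul (v := 0) (u := 2) (by decide) hR' h0 (N - N') fun w => by
    convert hf w using 2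
    simp; ring
  simp only [update_vecCons_zero] at hB1
  have hB2 := hB1.row_add_zsmul (v := 1) (u := 2) (by decide) hR' h1 (M - M') fun w => by
    convert hg w using 2
    simp; ring
  simp only [update_vecCons_one] at hB2
  convert hB2 using 2
  · simp only [Matrix.cons_val]
    module
  · simp only [Matrix.cons_val]
    congr 1
    module

end

/-- Outsplitting the second of two vertices. -/
theorem Realizes.exists_outsplit_two {e : Fin 2 → S} (he : CompleteOrthogonalIdempotents e)
    {a₀ a₁ b₀ b₁ : ℤ} (h : Realizes K e ![![a₀, a₁], ![b₀, b₁]]) (c₀ c₁ : ℕ) (h₀ : c₀ ≤ b₀)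
    (h₁ : c₁ ≤ b₁ + 1) : ∃ e' : Fin 3 → S, CompleteOrthogonalIdempotents e' ∧
      Realizes K e' ![![a₀, a₁, a₁], ![b₀ - c₀, b₁ - c₁, b₁ + 1 - c₁], ![c₀, c₁, c₁ - 1]] := by
  obtain ⟨g, hg, hB⟩ := h
  obtain ⟨ν, _, _, τ, hτ⟩ := exists_sum_equiv (g 1).lab
    (Sum.elim (fun _ => 0) (fun _ => 1) : Fin c₀ ⊕ Fin c₁ → Fin 2) (by
      change ∀ w, _ ≤ (g 1).mult w
      simp [Fin.forall_fin_two, hB, h₀, h₁, Fintype.sum_sum_type, -Finset.sum_boole])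
  let p : ∀ v, (g v).ι → Fin 3 := fun v => match v with
    | 0 => fun _ => 0
    | 1 => fun i => Sum.elim (fun _ => 1) (fun _ => 2) (τ.symm i)
  obtain ⟨e', he', g', hg', hm⟩ := hg.exists_outsplit he (![0, 1, 1] : Fin 3 → Fin 2) p
    fun v i => by
    match v with
    | 0 => rfl
    | 1 =>
      change ![0, 1, 1] (Sum.elim (fun _ => 1) (fun _ => 2) (τ.symm i) : Fin 3) = (1 : Fin 2)
      rcases τ.symm i with j | j <;> rfl
  have hm0 : ∀ w, (g' 0).mult w = (g 0).mult (![0, 1, 1] w) := fun w => by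
    rw [hm]
    exact Finset.sum_congr rfl fun i _ => if_congr (and_iff_right rfl) rfl rfl
  have hm2 : ∀ w, (g' 2).mult w = ∑ j : Fin c₀ ⊕ Fin c₁,
      if Sum.elim (fun _ => 0) (fun _ => 1) j = (![0, 1, 1] w : Fin 2) then 1 else 0 := fun w => by
    rw [hm]
    change ∑ i : (g 1).ι, (if Sum.elim (fun _ => 1) (fun _ => 2) (τ.symm i) = (2 : Fin 3) ∧
      (g 1).lab i = ![0, 1, 1] w then (1 : ℤ) else 0) = _
    rw [← Equiv.sum_comp τ, Fintype.sum_sum_type]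
    simp [hτ]
  have hm1 : ∀ w, (g' 1).mult w + (g' 2).mult w = (g 1).mult (![0, 1, 1] w) := fun w => by
    rw [hm2, hm, Row.mult, ← Equiv.sum_comp τ (fun i => if (g 1).lab i = _ then (1 : ℤ) else 0)]
    change ∑ i : (g 1).ι, (if Sum.elim (fun _ => 1) (fun _ => 2) (τ.symm i) = (1 : Fin 3) ∧
      (g 1).lab i = ![0, 1, 1] w then (1 : ℤ) else 0) + _ = _
    rw [← Equiv.sum_comp τ, Fintype.sum_sum_type,
      Fintype.sum_sum_type (fun j => if (g 1).lab (τ j) = _ then (1 : ℤ) else 0)]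
    simp [hτ, -Finset.sum_boole]
  refine ⟨e', he', g', hg', ?_⟩
  have key : ∀ w : Fin 3, (g' 1).mult w = (g 1).mult (![0, 1, 1] w) - (g' 2).mult w := fun w => by
    linarith [hm1 w]
  simp [Fin.forall_fin_succ, hm0, key, hm2, hB]
  ring

end ThreeVertices

section Surjection

variable {K S : Type} [Field K] [Ring S] [Algebra K S]

theorem update_vecCons_pair_zero {α : Type} (a b x : α) :
    Function.update ![a, b] 0 x = ![x, b] := by
  ext i; fin_cases i <;> rfl

theorem update_vecCons_pair_one {α : Type} (a b x : α) :
    Function.update ![a, b] 1 x = ![a, x] := by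
  ext i; fin_cases i <;> rfl

/-- An instance of Euclid's algorithm on the rows of a matrix. -/
theorem Realizes.exists_two_vertices {e : Fin 2 → S} {n d : ℤ} (hd : 2 ≤ d) (hdn : d ≤ n)
    (h : Realizes K e ![![n - 1, 0], ![d - 1, -1]]) (N : ℕ) :
    Realizes K e ![![n - d, 1], ![n - 1 + N * (n - d), N]] := by
  have h1 := h.row_minus (v := 0) (u := 1) (by decide) (by
    simp [Fin.forall_fin_two]
    linarith)
  simp only [update_vecCons_pair_zero] at h1
  have hpow : ∀ k : ℕ, Realizes K e ![![n - d, 1], ![d - 1 + k * (n - d), -1 + k]] := fun k => by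
    induction k with
    | zero => simpa using h1
    | succ k ih =>
      have hk := ih.row_plus (v := 1) (u := 0) (by decide) (by
        have := mul_nonneg (Nat.cast_nonneg (α := ℤ) k) (sub_nonneg.2 hdn)
        simp
        linarith)
      simp only [update_vecCons_pair_one] at hk
      convert hk using 1
      ext i j
      fin_cases i <;> fin_cases j <;> simp
      ring1
  convert hpow (N + 1) using 1
  ext i j
  fin_cases i <;> fin_cases j <;> simp
  ring1

/-- Euclid's algorithm on the first two of three rows. -/
theorem RealizesMod.exists_three_vertices {e : Fin 3 → S} {n d d' q : ℤ} (hd' : 2 ≤ d')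
    (hdn' : d' + 2 ≤ n) (hq : d * d' = 1 + q * (n - 1)) {N : ℤ}
    (h : RealizesMod K e 2 ![![n - d, 1, 1], ![n - 1 + N * (n - d), N, N], ![d', d' + 1, d']]) :
    Realizes K e ![![d' - 1, d', d'], ![n - 1 - d', n - 1 - d' - 1, n - 1 - d'], ![1, 1, 0]] := by
  have hR : ∀ w, 1 ≤ ![d', d' + 1, d'] w := by
    simp [Fin.forall_fin_succ]
    omega
  let A : Matrix.SpecialLinearGroup (Fin 2) ℤ :=
    ⟨!![d' - N * (q - d'), q - d'; n - 1 - N * (1 - n + d), 1 - n + d], by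
      rw [Matrix.det_fin_two_of]
      linear_combination hq⟩
  have h1 := h.specialLinearGroup_smul hR A
  have h2 : RealizesMod K e 2
      ![![d' - 1, d', d'], ![n - 1, n - 1, n - 1], ![d', d' + 1, d']] := by
    convert h1 using 1
    ext i j
    fin_cases i <;> fin_cases j <;> simp [A] <;> first | ring1 | linear_combination hq
  have h3 := h2.realizes hR 0 (-1) (by
    simp [Fin.forall_fin_succ]
    omega) (by
    simp [Fin.forall_fin_succ]
    omega)
  have h4 := h3.row_minus (v := 2) (u := 0) (by decide) (by simp [Fin.forall_fin_succ])
  rw [update_vecCons_two] at h4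
  convert h4 using 1
  ext i j
  fin_cases i <;> fin_cases j <;> simp <;> ring1

theorem exists_leavitt_surjective_matrix (K : Type) [Field K] {n d d' q : ℕ} (hd : 2 ≤ d)
    (hdn : d + 2 ≤ n) (hd' : 2 ≤ d') (hdn' : d' + 2 ≤ n) (hq : d * d' = 1 + q * (n - 1)) :
    ∃ φ : Leavitt K n →ₐ[K] Matrix (Fin d) (Fin d) (Leavitt K n), Function.Surjective φ := by
  obtain ⟨k, rfl⟩ : ∃ k, d = k + 1 := ⟨d - 1, by omega⟩
  obtain ⟨m, rfl⟩ : ∃ m, n = m + 1 := ⟨n - 1, by omega⟩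
  obtain ⟨e, he, h⟩ := exists_realizes_matrix K (m + 1) k
  have h1 := Realizes.exists_two_vertices (n := (m + 1 : ℕ)) (d := (k + 1 : ℕ)) (by omega)
    (by omega) (by simpa using h) (d' + 2)
  have hpos : (0 : ℤ) ≤ (d' + 2) * (m - k) := mul_nonneg (by omega) (by omega)
  obtain ⟨e', he', h2⟩ := h1.exists_outsplit_two he d' (d' + 1)
    (by push_cast; linarith) (by push_cast; linarith)
  have h3 : Realizes K e' _ := RealizesMod.exists_three_vertices (n := (m + 1 : ℕ))
    (d := (k + 1 : ℕ)) (d' := d') (q := q) (N := d' + 2) (by omega) (by omega)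
    (by simpa using congrArg (Nat.cast : ℕ → ℤ) hq) (by
      refine ⟨_, h2, ?_, ?_⟩
      · ext i; fin_cases i <;> simp
      · intro v hv
        fin_cases v
        · refine ⟨?_, 0, ?_⟩
          · simp [Fin.forall_fin_succ]
            omega
          · simp
        · refine ⟨?_, -1, ?_⟩
          · simp [Fin.forall_fin_succ]
            linarith
          · ext i; fin_cases i <;> simp <;> ring
        · exact absurd rfl hv)
  refine Realizes.exists_leavitt_surjective he' ![d', m - d', 1] ?_ ?_
  · simp [Fin.sum_univ_three]
    omega
  · convert h3 using 1
    have : ((m - d' : ℕ) : ℤ) = m - d' := by omega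
    ext i j
    fin_cases i <;> fin_cases j <;> simp [this]

end Surjection

section MatrixIso

variable {K A : Type} [Field K] [Ring A] [Algebra K A]

/-- Conjugation by a rectangular invertible matrix. -/
def algEquivOfMulEqOne {ι κ : Type} [Fintype ι] [DecidableEq ι] [Fintype κ] [DecidableEq κ]
    (P : Matrix ι κ A) (Q : Matrix κ ι A) (hPQ : P * Q = 1) (hQP : Q * P = 1) :
    Matrix ι ι A ≃ₐ[K] Matrix κ κ A where
  toFun X := Q * X * P
  invFun Y := P * Y * Q
  left_inv X := by
    simp only [Matrix.mul_assoc, hPQ, Matrix.mul_one]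
    rw [← Matrix.mul_assoc, hPQ, Matrix.one_mul]
  right_inv Y := by
    simp only [Matrix.mul_assoc, hQP, Matrix.mul_one]
    rw [← Matrix.mul_assoc, hQP, Matrix.one_mul]
  map_mul' X Y := by
    simp only [Matrix.mul_assoc]
    rw [← Matrix.mul_assoc P Q, hPQ, Matrix.one_mul]
  map_add' X Y := by simp only [Matrix.mul_add, Matrix.add_mul]
  commutes' c := by
    simp only [Algebra.algebraMap_eq_smul_one, Matrix.mul_smul, Matrix.smul_mul,
      Matrix.mul_one, hQP]

variable (K A) in
/-- An algebra is its own algebra of `1 × 1` matrices. -/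
def algEquivMatrixFinOne : A ≃ₐ[K] Matrix (Fin 1) (Fin 1) A where
  toFun a := Matrix.of fun _ _ => a
  invFun M := M 0 0
  left_inv _ := rfl
  right_inv M := by
    ext i j
    fin_cases i; fin_cases j; rfl
  map_mul' a b := by
    ext i j
    simp [Matrix.mul_apply]
  map_add' _ _ := rfl
  commutes' c := by
    ext i j
    simp [Matrix.algebraMap_matrix_apply, Subsingleton.elim i j]

variable (K A) in
/-- Matrix algebras of sizes `r` and `s` are isomorphic. -/
def MatrixIso (r s : ℕ) : Prop :=
  Nonempty (Matrix (Fin r) (Fin r) A ≃ₐ[K] Matrix (Fin s) (Fin s) A)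

theorem MatrixIso.symm {r s : ℕ} (h : MatrixIso K A r s) : MatrixIso K A s r :=
  h.map AlgEquiv.symm

theorem MatrixIso.trans {r s t : ℕ} (h : MatrixIso K A r s) (h' : MatrixIso K A s t) :
    MatrixIso K A r t :=
  h.elim fun φ => h'.map φ.trans

theorem MatrixIso.mul {r : ℕ} (h : MatrixIso K A 1 r) (s : ℕ) : MatrixIso K A s (r * s) := by
  obtain ⟨φ⟩ := h
  exact ⟨(((algEquivMatrixFinOne K A).trans φ).mapMatrix.trans
    (Matrix.compAlgEquiv (Fin s) (Fin r) A K)).trans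
      (Matrix.reindexAlgEquiv K A ((Equiv.prodComm _ _).trans finProdFinEquiv))⟩

variable {n : ℕ}

theorem matrixIso_add (r : ℕ) (hn : 1 ≤ n) (hr : 1 ≤ r) :
    MatrixIso K (Leavitt K n) r (r + (n - 1)) := by
  let P : Matrix (Fin (r - 1) ⊕ Unit) (Fin (r - 1) ⊕ Fin n) (Leavitt K n) :=
    Matrix.fromBlocks 1 0 0 (Matrix.of fun _ j => ly K n j)
  let Q : Matrix (Fin (r - 1) ⊕ Fin n) (Fin (r - 1) ⊕ Unit) (Leavitt K n) :=
    Matrix.fromBlocks 1 0 0 (Matrix.of fun i _ => lx K n i)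
  have hPQ : P * Q = 1 := by
    rw [Matrix.fromBlocks_multiply, ← Matrix.fromBlocks_one]
    congr 1
    · simp
    · simp
    · simp
    · ext
      simp [Matrix.mul_apply, sum_ly_mul_lx]
  have hQP : Q * P = 1 := by
    rw [Matrix.fromBlocks_multiply, ← Matrix.fromBlocks_one]
    congr 1
    · simp
    · simp
    · simp
    · ext i j
      simp [Matrix.mul_apply, lx_mul_ly, Matrix.one_apply]
  exact ⟨((Matrix.reindexAlgEquiv K _ (Fintype.equivOfCardEq (by simp; omega))).trans
    (algEquivOfMulEqOne P Q hPQ hQP)).trans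
      (Matrix.reindexAlgEquiv K _ (Fintype.equivOfCardEq (by simp; omega)))⟩

theorem matrixIso_of_modEq {r s : ℕ} (hn : 1 ≤ n) (hr : 1 ≤ r) (hs : 1 ≤ s)
    (h : r ≡ s [MOD n - 1]) : MatrixIso K (Leavitt K n) r s := by
  wlog hrs : r ≤ s generalizing r s
  · exact (this hs hr h.symm (by omega)).symm
  obtain ⟨k, hk⟩ := (Nat.modEq_iff_dvd' hrs).1 h
  obtain rfl : s = r + (n - 1) * k := by omega
  clear hk h hs hrs
  induction k with
  | zero => exact ⟨AlgEquiv.refl⟩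
  | succ k ih =>
    rw [Nat.mul_succ, ← add_assoc]
    exact ih.trans (matrixIso_add _ hn (by omega))

theorem matrixIso_one_of_coprime {u : ℕ} (hn : 2 ≤ n) (hu : 1 ≤ u) (h : u.Coprime (n - 1)) :
    MatrixIso K (Leavitt K n) 1 u := by
  have hmod := Nat.mod_modEq u (n - 1)
  have hlt := Nat.mod_lt u (show 0 < n - 1 by omega)
  set d := u % (n - 1) with hd
  have hdc : d.Coprime (n - 1) := hmod.gcd_eq.trans h
  by_cases h1 : 1 ≡ d [MOD n - 1]
  · exact matrixIso_of_modEq (by omega) le_rfl hu (h1.trans hmod)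
  have hn1 : 1 < n - 1 := by
    by_contra hn1
    obtain hn1 : n - 1 = 1 := by omega
    rw [hn1] at h1
    exact h1 Nat.modEq_one
  have hd0 : d ≠ 0 := fun h0 => by
    rw [h0, Nat.coprime_zero_left] at hdc
    omega
  have hd1 : d ≠ 1 := fun h0 => h1 (h0 ▸ rfl)
  obtain ⟨d', hd', hdd⟩ := Nat.exists_mul_mod_eq_one_of_coprime hdc hn1
  have hd'0 : d' ≠ 0 := by rintro rfl; simp at hdd
  have hd'1 : d' ≠ 1 := by
    rintro rfl
    rw [mul_one, Nat.mod_eq_of_lt hlt] at hdd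
    exact hd1 hdd
  obtain ⟨φ, hφ⟩ := exists_leavitt_surjective_matrix K (n := n) (d := d) (d' := d')
    (q := d * d' / (n - 1)) (by omega) (by omega) (by omega) (by omega) (by
      have hdiv := Nat.mod_add_div (d * d') (n - 1)
      rw [hdd] at hdiv
      rw [mul_comm (d * d' / (n - 1)), hdiv])
  have hinj : Function.Injective φ := by
    have : NeZero d := ⟨hd0⟩
    cases subsingleton_or_nontrivial (Leavitt K n)
    · exact Function.injective_of_subsingleton _
    · exact leavitt_hom_injective hn φ
  have hiso : MatrixIso K (Leavitt K n) 1 d :=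
    ⟨(algEquivMatrixFinOne K _).symm.trans (AlgEquiv.ofBijective φ ⟨hinj, hφ⟩)⟩
  exact hiso.trans (matrixIso_of_modEq (by omega) (by omega) hu hmod)

theorem matrixIso_gcd {r : ℕ} (hn : 2 ≤ n) (hr : 1 ≤ r) :
    MatrixIso K (Leavitt K n) (r.gcd (n - 1)) r := by
  have : NeZero (n - 1) := ⟨by omega⟩
  obtain ⟨d, hd, u, hu, h⟩ := ZMod.eq_unit_mul_divisor (r : ZMod (n - 1))
  obtain ⟨u, rfl⟩ := hu
  let t := (u : ZMod (n - 1)).val + (n - 1)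
  have ht : (t : ZMod (n - 1)) = u := by simp [t]
  have htc : t.Coprime (n - 1) := by
    rw [← ZMod.isUnit_iff_coprime, ht]
    exact u.isUnit
  have hmod : t * d ≡ r [MOD n - 1] := by
    rw [← ZMod.natCast_eq_natCast_iff, Nat.cast_mul, ht, h]
  have hgcd : r.gcd (n - 1) = d := by
    rw [← hmod.gcd_eq, Nat.Coprime.gcd_mul_left_cancel _ htc, Nat.gcd_eq_left hd]
  have hd0 : 0 < d := Nat.pos_of_dvd_of_pos hd (by omega)
  rw [hgcd]
  exact ((matrixIso_one_of_coprime hn (by omega) htc).mul d).trans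
    (matrixIso_of_modEq (by omega) (Nat.mul_pos (by omega) hd0) hr hmod)

end MatrixIso

/-- If `gcd r (n-1) = gcd s (n-1)` then `M_r(L_n)` and `M_s(L_n)` are isomorphic
`K`-algebras. -/
theorem leavitt_matrix_iso_of_gcd_eq (K : Type) [Field K] (n : ℕ) (hn : 2 ≤ n)
    (r s : ℕ) (hr : 1 ≤ r) (hs : 1 ≤ s)
    (hgcd : Nat.gcd r (n - 1) = Nat.gcd s (n - 1)) :
    Nonempty (Matrix (Fin r) (Fin r) (Leavitt K n) ≃ₐ[K]
      Matrix (Fin s) (Fin s) (Leavitt K n)) := by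
  have h := (matrixIso_gcd (K := K) hn hr).symm
  rw [hgcd] at h
  exact h.trans (matrixIso_gcd hn hs)
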